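/- Let k ≥ 1 and d ≥ 2 be integers, let r ≥ 1 be a real number, let m ∈ {0,1,…,d} be even, and let α = (a₁,…,a_d) be a tuple of points in ℝ^k such that exactly m of the points have Euclidean norm strictly greater than r, and these m points can be partitioned into m/2 pairs in which the two points of each pair have equal Euclidean norm. Then M(α)^(2d−3) ≥ (2r)^(d(1−d)) · |Δ(α)|, where M(α) = ∏_{i=1}^{d} max{1,|a_i|} and Δ(α) = ∏_{1≤i<j≤d} |a_i − a_j|². -/

import Mathlib

open Finset

lemma prod_pairs_symm {d : ℕ} (f : Fin d → Fin d → ℝ) (hf : ∀ i j, f i j = f j i) :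
    ∏ i, ∏ j ∈ univ.filter (fun j => i < j), f i j ^ 2 = ∏ i, ∏ j ∈ univ.erase i, f i j := by
  have h1 : ∀ i : Fin d, ∏ j ∈ univ.erase i, f i j =
      (∏ j ∈ univ.filter (fun j => i < j), f i j) *
        ∏ j ∈ univ.filter (fun j => j < i), f i j := by
    intro i
    rw [← Finset.prod_union]
    · congr 1
      ext j
      simp only [mem_erase, mem_univ, mem_union, mem_filter]
      grind
    · rw [Finset.disjoint_left]
      intro j
      simp only [mem_filter]
      grind
  have h2 : ∏ i, ∏ j ∈ univ.filter (fun j => j < i), f i j =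
      ∏ i, ∏ j ∈ univ.filter (fun j => i < j), f i j := by
    rw [Finset.prod_comm' (t' := univ) (s' := fun i => univ.filter (fun j => i < j))]
    · exact Finset.prod_congr rfl fun i _ => Finset.prod_congr rfl fun j _ => hf _ _
    · simp
  simp_rw [h1, Finset.prod_mul_distrib, h2, Finset.prod_pow, sq]

lemma prod_max_bound {d : ℕ} (hd : 2 ≤ d) (x : Fin d → ℝ) (hx : ∀ i, 1 ≤ x i)
    (σ : Fin d → Fin d) (hs : ∀ i, x (σ i) = x i) (hfix : ∀ i, σ i = i → x i = 1) :
    ∏ i, ∏ j ∈ univ.erase i, max (x i) (x j) ≤ (∏ i, x i) ^ (2 * d - 3) := by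
  have h1 : ∀ i, (∏ j ∈ univ.erase i, max (x i) (x j)) * x i ≤
      x i ^ (d - 2) * ∏ j, x j := by
    intro i
    have h : ∏ j ∈ univ.erase i, (max (x i) (x j) * (if σ i = j then x i else 1)) ≤
        ∏ j ∈ univ.erase i, (x i * x j) := by
      apply Finset.prod_le_prod
      · intro j _
        have := hx i
        have := hx j
        split_ifs <;> positivity
      · intro j _
        have hi := hx i
        have hj := hx j
        split_ifs with hij
        · rw [← hij, hs i, max_self]
        · rw [mul_one]
          apply max_le <;> nlinarith
    rw [Finset.prod_mul_distrib, Finset.prod_ite_eq, Finset.prod_mul_distrib,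
      Finset.prod_const, Finset.card_erase_of_mem (mem_univ i), Finset.card_univ,
      Fintype.card_fin] at h
    have e : (if σ i ∈ univ.erase i then x i else 1) = x i := by
      split_ifs with hh
      · rfl
      · have : σ i = i := by simpa using hh
        exact (hfix i this).symm
    rw [e] at h
    have e2 : x i ^ (d - 2) * ∏ j, x j = x i ^ (d - 1) * ∏ j ∈ univ.erase i, x j := by
      rw [← Finset.mul_prod_erase univ x (mem_univ i), ← mul_assoc, ← pow_succ]
      congr 2
      omega
    rw [e2]
    exact h
  have hP : 0 < ∏ i, x i := Finset.prod_pos fun i _ => lt_of_lt_of_le one_pos (hx i)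
  have h2 := Finset.prod_le_prod (s := univ) (fun i _ => by
    have := hx i
    have : 0 ≤ ∏ j ∈ univ.erase i, max (x i) (x j) :=
      Finset.prod_nonneg fun j _ => le_trans (by linarith) (le_max_left _ _)
    positivity) (fun i _ => h1 i)
  rw [Finset.prod_mul_distrib, Finset.prod_mul_distrib, Finset.prod_pow, Finset.prod_const,
    Finset.card_univ, Fintype.card_fin, ← pow_add] at h2
  have e3 : d - 2 + d = (2 * d - 3) + 1 := by omega
  rw [e3, pow_succ] at h2
  exact le_of_mul_le_mul_right h2 hP

/-- **Theorem (point configurations).** Let `k ≥ 1`, `d ≥ 2`, `r ≥ 1`, and let `m` be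
even with `0 ≤ m ≤ d`. Let `a₁, …, a_d` be points in `ℝ^k` such that exactly `m` of
them have Euclidean norm strictly greater than `r`, and these `m` points can be
partitioned into pairs of equal Euclidean norm (the pairing being given by a
fixed-point-free norm-preserving involution on the large points). Then
`M(α)^(2d-3) ≥ (2r)^(d(1-d)) |Δ(α)|`, where `M(α) = ∏ max{1,|aᵢ|}` and
`|Δ(α)| = ∏_{i<j} |aᵢ - aⱼ|²`. -/
theorem energy_lower_bound (k d m : ℕ) (hk : 1 ≤ k) (hd : 2 ≤ d) (hm : Even m)
    (hmd : m ≤ d) (r : ℝ) (hr : 1 ≤ r) (a : Fin d → EuclideanSpace ℝ (Fin k))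
    (hcard : (univ.filter fun i => r < ‖a i‖).card = m)
    (hpair : ∃ σ : Equiv.Perm (Fin d), (∀ i, σ (σ i) = i) ∧
      ∀ i, r < ‖a i‖ → σ i ≠ i ∧ ‖a (σ i)‖ = ‖a i‖) :
    (∏ i, max 1 ‖a i‖) ^ (2 * d - 3) ≥
      (2 * r) ^ ((d : ℤ) * (1 - (d : ℤ))) *
        ∏ i, ∏ j ∈ univ.filter (fun j => i < j), ‖a i - a j‖ ^ 2 := by
  obtain ⟨σ, hσ, hσ2⟩ := hpair
  have hr0 : 0 < r := by linarith
  set x : Fin d → ℝ := fun i => max 1 (‖a i‖ / r) with hxdef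
  have hx : ∀ i, 1 ≤ x i := fun i => le_max_left _ _
  have hsmall : ∀ i, ¬ r < ‖a i‖ → x i = 1 := by
    intro i hi
    exact max_eq_left ((div_le_one hr0).2 (not_lt.1 hi))
  have hs : ∀ i, x (σ i) = x i := by
    intro i
    by_cases hi : r < ‖a i‖
    · simp only [hxdef, (hσ2 i hi).2]
    · by_cases hi2 : r < ‖a (σ i)‖
      · have := (hσ2 _ hi2).2
        rw [hσ] at this
        simp only [hxdef, this]
      · rw [hsmall _ hi, hsmall _ hi2]
  have hfix : ∀ i, σ i = i → x i = 1 := by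
    intro i hi
    exact hsmall i fun h => (hσ2 i h).1 hi
  have key := prod_max_bound hd x hx σ hs hfix
  have hle : ∀ i, ‖a i‖ ≤ r * x i := by
    intro i
    have : ‖a i‖ / r ≤ x i := le_max_right _ _
    rwa [div_le_iff₀' hr0] at this
  have hxM : ∏ i, x i ≤ ∏ i, max 1 ‖a i‖ := by
    apply Finset.prod_le_prod
    · intro i _
      linarith [hx i]
    · intro i _
      exact max_le_max le_rfl (div_le_self (norm_nonneg _) hr)
  have hx0 : 0 ≤ ∏ i, x i := Finset.prod_nonneg fun i _ => by linarith [hx i]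
  have hD : ∏ i, ∏ j ∈ univ.erase i, ‖a i - a j‖ ≤
      ∏ i, ∏ j ∈ univ.erase i, (2 * r * max (x i) (x j)) := by
    apply Finset.prod_le_prod
    · intro i _
      exact Finset.prod_nonneg fun j _ => norm_nonneg _
    · intro i _
      apply Finset.prod_le_prod
      · intro j _
        exact norm_nonneg _
      · intro j _
        have h1 := norm_sub_le (a i) (a j)
        have h2 := mul_le_mul_of_nonneg_left (le_max_left (x i) (x j)) hr0.le
        have h3 := mul_le_mul_of_nonneg_left (le_max_right (x i) (x j)) hr0.le
        linarith [hle i, hle j]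
  have hc : ∏ i : Fin d, ∏ j ∈ univ.erase i, (2 * r * max (x i) (x j)) =
      (2 * r) ^ (d * (d - 1)) * ∏ i, ∏ j ∈ univ.erase i, max (x i) (x j) := by
    simp_rw [Finset.prod_mul_distrib]
    congr 1
    simp only [Finset.prod_const, Finset.card_erase_of_mem (mem_univ _), Finset.card_univ,
      Fintype.card_fin]
    rw [← mul_pow, ← mul_pow, ← pow_mul, mul_comm (d - 1) d]
  have hz : (2 * r) ^ ((d : ℤ) * (1 - (d : ℤ))) = ((2 * r) ^ (d * (d - 1)))⁻¹ := by
    rw [← zpow_natCast, ← zpow_neg]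
    congr 1
    push_cast [Nat.cast_sub (show 1 ≤ d by omega)]
    ring
  rw [prod_pairs_symm (fun i j => ‖a i - a j‖) (fun i j => norm_sub_rev _ _), hz, ge_iff_le,
    inv_mul_le_iff₀ (by positivity)]
  calc _ ≤ _ := hD
    _ = _ := hc
    _ ≤ _ := mul_le_mul_of_nonneg_left (key.trans (pow_le_pow_left₀ hx0 hxM _)) (by positivity)
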